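/- Let α > 0, let β ∈ ℝ, and let x ∈ (0,1) be irrational with regular continued fraction convergent denominators (Q_n)_{n≥0}. If Σ_{n=1}^{∞} Q_{n+1}^{β} / Q_n^{α+β} < ∞, then the series Σ_{j=0}^{∞} e^{(iπ/4) Σ_{ℓ=0}^{j−1} σ(T^ℓ(x))} (Π_{ℓ=0}^{j−1} |T^ℓ(x)|)^{α} / |T^j(x)|^{β} converges (i.e., its partial sums converge; empty products and sums for j = 0 are 1 and 0 respectively). -/

import Mathlib

open Complex Filter Finset

noncomputable section

/-- `ρ = e^{iπ/4}`. -/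
def ρ : ℂ := Complex.exp (Real.pi * Complex.I / 4)

/-- Partial sum `F_{s,n}(x,t) = Σ_{k=1}^{n} e^{iπk²x + 2πikt}/k^s`. -/
def Fpart (s : ℝ) (n : ℕ) (x t : ℝ) : ℂ :=
  ∑ k ∈ Finset.Icc 1 n,
    Complex.exp (Real.pi * Complex.I * (k : ℂ) ^ 2 * (x : ℂ)
        + 2 * Real.pi * Complex.I * (k : ℂ) * (t : ℂ)) / (k : ℂ) ^ (s : ℂ)

/-- The function `I_s(x,t)` (for `x > 0`). -/
def Ifun (s x t : ℝ) : ℂ :=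
  (∫ u : ℝ, ρ *
      (Complex.exp (Real.pi * Complex.I * ((1 : ℂ) / 2 + ρ * (u : ℂ)) ^ 2 * (x : ℂ)
            + 2 * Real.pi * Complex.I * ((1 : ℂ) / 2 + ρ * (u : ℂ)) * (Int.fract t : ℝ)) /
        (((1 : ℂ) / 2 + ρ * (u : ℂ)) ^ (s : ℂ) *
          (1 - Complex.exp (2 * Real.pi * Complex.I * ((1 : ℂ) / 2 + ρ * (u : ℂ)))))))
  + ρ * (x : ℂ) ^ (s : ℂ) *
    ∫ u : ℝ, (Real.exp (-(Real.pi * x * u ^ 2)) : ℝ) *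
      ∑' k : ℕ, Complex.exp (-(Real.pi * Complex.I * (((k : ℂ) + 1) - (Int.fract t : ℝ)) ^ 2 / (x : ℂ))) *
        (((ρ * (x : ℂ) * (u : ℂ) + ((k : ℂ) + 1) - (Int.fract t : ℝ)) ^ (s : ℂ))⁻¹
          - (((k : ℂ) + 1) ^ (s : ℂ))⁻¹)

/-- `Ω_s(x,t)`. -/
def Omega (s x t : ℝ) : ℂ :=
  if 0 < x then Ifun s x t else (starRingEnd ℂ) (Ifun s (-x) (-t))

/-- `Ω_s(x) = Ω_s(x,0)`. -/
def Omega0 (s x : ℝ) : ℂ := Omega s x 0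

/-- The map `T(x) = -1/x mod 2`, valued in `(-1,1]`. -/
def Tmap (x : ℝ) : ℝ := -1 / x - 2 * ⌈((-1 / x) - 1) / 2⌉

/-- Denominator `Q_n` of the `n`-th convergent of the regular continued fraction of `x`. -/
def Qden (x : ℝ) (n : ℕ) : ℝ := (GenContFract.of x).dens n

end

open scoped Topology

theorem exists_tendsto_sum_of_summation_by_parts {c κ : ℕ → ℂ} {f : ℕ → ℝ} {K : ℝ}
    (hc : ∀ j, ‖c j‖ = 1) (hκ : ∀ j, (c (j + 1) - c j) * κ j = c j) (hK : ∀ j, ‖κ j‖ ≤ K)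
    (hf : Tendsto f atTop (𝓝 0))
    (hs : Summable fun j => ‖κ (j + 1) * f (j + 1) - κ j * f j‖) :
    ∃ L : ℂ, Tendsto (fun N : ℕ => ∑ j ∈ Finset.range N, c j * (f j : ℂ)) atTop (𝓝 L) := by
  have hs' : Summable fun j => c (j + 1) * (κ (j + 1) * f (j + 1) - κ j * f j) :=
    Summable.of_norm (by simpa [hc] using hs)
  have hb : Tendsto (fun N => c N * (κ N * f N)) atTop (𝓝 0) := by
    refine squeeze_zero_norm (a := fun N => K * |f N|) (fun N => ?_) ?_
    · rw [norm_mul, norm_mul, hc, one_mul, Complex.norm_real, Real.norm_eq_abs]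
      gcongr
      exact hK N
    · simpa using (hf.abs).const_mul K
  refine ⟨_, ((hb.sub_const (c 0 * (κ 0 * f 0))).sub hs'.hasSum.tendsto_sum_nat).congr
    fun N => ?_⟩
  rw [← Finset.sum_range_sub (fun j => c j * (κ j * f j)), ← Finset.sum_sub_distrib]
  refine Finset.sum_congr rfl fun j _ => ?_
  linear_combination (f j : ℂ) * hκ j

theorem rpow_le_two_rpow_abs {z : ℝ} (hz : 1 / 2 ≤ z) (hz' : z ≤ 1) (e : ℝ) :
    z ^ e ≤ 2 ^ |e| := by
  have h0 : 0 < z := by linarith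
  rcases le_total 0 e with he | he
  · exact (Real.rpow_le_one h0.le hz' he).trans (Real.one_le_rpow (by norm_num) (abs_nonneg e))
  · rw [abs_of_nonpos he]
    calc z ^ e ≤ (1 / 2 : ℝ) ^ e := Real.rpow_le_rpow_of_nonpos (by norm_num) hz he
      _ = 2 ^ (-e) := by
        rw [one_div, Real.inv_rpow (by norm_num), Real.rpow_neg (by norm_num)]

theorem one_sub_le_mul_one_sub_rpow {α y : ℝ} (hα : 0 < α) (hy : 0 < y) (hy' : y < 1) :
    1 - y ≤ (1 + 1 / α) * (1 - y ^ α) := by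
  have h1 : y ^ α ≤ 1 := Real.rpow_le_one hy.le hy'.le hα.le
  have hi : 0 < 1 / α := by positivity
  rcases le_total 1 α with h | h
  · have := Real.rpow_le_rpow_of_exponent_ge hy hy'.le h
    rw [Real.rpow_one] at this
    nlinarith
  · have := rpow_one_add_le_one_add_mul_self (s := y - 1) (by linarith) hα.le h
    rw [add_sub_cancel] at this
    have h2 : 1 / α * (α * (1 - y)) = 1 - y := by field_simp
    nlinarith [mul_le_mul_of_nonneg_left (show α * (1 - y) ≤ 1 - y ^ α by linarith) hi.le]

theorem abs_rpow_sub_rpow_le {y z : ℝ} (hy : 1 / 2 ≤ y) (hy' : y ≤ 1) (hz : 1 / 2 ≤ z)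
    (hz' : z ≤ 1) (e : ℝ) : |z ^ e - y ^ e| ≤ |e| * 2 ^ |e - 1| * |z - y| := by
  refine Convex.norm_image_sub_le_of_norm_hasDerivWithin_le (s := Set.Icc (1 / 2) 1)
    (f := fun t : ℝ => t ^ e) (f' := fun t => e * t ^ (e - 1)) (fun t ht => ?_) (fun t ht => ?_)
    (convex_Icc _ _) ⟨hy, hy'⟩ ⟨hz, hz'⟩
  · have ht0 : t ≠ 0 := by linarith [ht.1]
    exact (Real.hasDerivAt_rpow_const (Or.inl ht0)).hasDerivWithinAt
  · have ht0 : 0 ≤ t := by linarith [ht.1]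
    rw [norm_mul, Real.norm_eq_abs, Real.norm_eq_abs, abs_of_nonneg (Real.rpow_nonneg ht0 _)]
    gcongr
    exact rpow_le_two_rpow_abs ht.1 ht.2 _

/-- Near the parabolic fixed points the variation of `p ^ α / |x| ^ β` is controlled by that
of `p ^ α`. -/
theorem exists_abs_rpow_mul_sub_le {α : ℝ} (hα : 0 < α) (β : ℝ) :
    ∃ C : ℝ, 0 ≤ C ∧ ∀ y : ℝ, 2 / 3 ≤ y → y < 1 →
      |y ^ α / (2 - 1 / y) ^ β - 1 / y ^ β| ≤ C * (1 - y ^ α) := by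
  refine ⟨2 ^ |-β| + |-β| * 2 ^ |-β - 1| * (1 + 1 / α), by positivity, fun y hy hy' => ?_⟩
  have hy0 : 0 < y := by linarith
  have hinv : y * (1 / y) = 1 := by field_simp
  have hi : 1 / y ≤ 3 / 2 := by nlinarith
  have hi' : 1 < 1 / y := by nlinarith
  set z := 2 - 1 / y with hz
  have h1 : y ^ α ≤ 1 := Real.rpow_le_one hy0.le hy'.le hα.le
  have hz1 : 1 / 2 ≤ z := by linarith
  have hz2 : z ≤ 1 := by linarith
  have hd : |z - y| ≤ 1 - y := by
    rw [abs_le]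
    constructor <;> nlinarith
  have e1 : y ^ α / z ^ β - 1 / y ^ β = -(z ^ (-β) * (1 - y ^ α)) + (z ^ (-β) - y ^ (-β)) := by
    rw [Real.rpow_neg (by linarith), Real.rpow_neg hy0.le]
    ring
  rw [e1]
  refine (abs_add_le _ _).trans ?_
  rw [abs_neg, abs_of_nonneg (mul_nonneg (Real.rpow_nonneg (by linarith) _) (by linarith)), add_mul]
  refine add_le_add ?_ ?_
  · exact mul_le_mul_of_nonneg_right (rpow_le_two_rpow_abs hz1 hz2 _) (by linarith)
  · refine (abs_rpow_sub_rpow_le (by linarith) hy'.le hz1 hz2 _).trans ?_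
    rw [mul_assoc _ (1 + 1 / α)]
    exact mul_le_mul_of_nonneg_left (hd.trans (one_sub_le_mul_one_sub_rpow hα hy0 hy'))
      (by positivity)

theorem Tmap_eq_of_eq {x z : ℝ} (m : ℤ) (h : -1 / x = 2 * m + z) (hz : -1 < z) (hz' : z ≤ 1) :
    Tmap x = z := by
  have : ⌈(-1 / x - 1) / 2⌉ = m := by
    rw [Int.ceil_eq_iff, h]
    constructor <;> linarith
  rw [Tmap, this, h]
  ring

theorem Tmap_eq_sign_mul {x r : ℝ} (hx : x ≠ 0) (m : ℤ) (h : 1 / |x| = 2 * m + r)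
    (hr : |r| < 1) : Tmap x = -(Real.sign x * r) := by
  obtain ⟨h1, h2⟩ := abs_lt.1 hr
  rcases hx.lt_or_gt with h0 | h0
  · rw [abs_of_neg h0] at h
    rw [Real.sign_of_neg h0]
    refine Tmap_eq_of_eq m ?_ (by linarith) (by linarith)
    rw [one_div_neg_eq_neg_one_div, ← neg_div] at h
    linarith
  · rw [abs_of_pos h0] at h
    rw [Real.sign_of_pos h0]
    refine Tmap_eq_of_eq (-m) ?_ (by linarith) (by linarith)
    push_cast
    rw [neg_div, h]
    ring

theorem abs_Tmap_eq {x r : ℝ} (hx : x ≠ 0) (m : ℤ) (h : 1 / |x| = 2 * m + r)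
    (hr : |r| < 1) : |Tmap x| = |r| := by
  rw [Tmap_eq_sign_mul hx m h hr, abs_neg, abs_mul]
  rcases hx.lt_or_gt with h0 | h0
  · simp [Real.sign_of_neg h0]
  · simp [Real.sign_of_pos h0]

/-- If `1 / |x|` has integer part `c`, then `|T x|` is the fractional part of `1 / |x|` or its
complement, according to the parity of `c`. -/
theorem abs_Tmap_eq_or {x t : ℝ} (hx : x ≠ 0) (c : ℕ) (h : 1 / |x| = c + t) (ht : 0 < t)
    (ht' : t < 1) : |Tmap x| = t ∨ |Tmap x| = 1 - t := by
  rcases Nat.even_or_odd' c with ⟨m, rfl | rfl⟩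
  · left
    rw [abs_Tmap_eq hx m (r := t) (by rw [h]; push_cast; ring) (by rwa [abs_of_pos ht]),
      abs_of_pos ht]
  · right
    rw [abs_Tmap_eq hx (m + 1) (r := t - 1) (by rw [h]; push_cast; ring)
      (by rw [abs_of_neg] <;> linarith), abs_of_neg (by linarith)]
    ring

theorem Tmap_of_half_lt {x : ℝ} (hx : 1 / 2 < |x|) (hx' : |x| < 1) :
    |Tmap x| = 2 - 1 / |x| ∧ Real.sign (Tmap x) = Real.sign x := by
  have hinv : |x| * (1 / |x|) = 1 := by
    have : |x| ≠ 0 := by linarith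
    field_simp
  have hi : 1 / |x| < 2 := by nlinarith
  have hi' : 1 < 1 / |x| := by nlinarith
  have h0 : x ≠ 0 := by
    rintro rfl
    norm_num at hx
  have hr : |1 / |x| - 2| < 1 := by rw [abs_of_neg] <;> linarith
  have h : 1 / |x| = 2 * (1 : ℤ) + (1 / |x| - 2) := by push_cast; ring
  refine ⟨?_, ?_⟩
  · rw [abs_Tmap_eq h0 1 h hr, abs_of_neg (by linarith)]
    ring
  · rw [Tmap_eq_sign_mul h0 1 h hr]
    rcases h0.lt_or_gt with h0 | h0
    · rw [Real.sign_of_neg h0, Real.sign_of_neg (by linarith)]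
    · rw [Real.sign_of_pos h0, Real.sign_of_pos (by linarith)]

theorem irrational_Tmap {x : ℝ} (hx : Irrational x) : Irrational (Tmap x) := by
  have h : Tmap x = -x⁻¹ - ((2 * ⌈((-1 / x) - 1) / 2⌉ : ℤ) : ℝ) := by
    rw [Tmap]
    push_cast
    ring
  rw [h]
  exact (irrational_inv_iff.2 hx).neg.sub_intCast _

theorem abs_Tmap_lt_one {x : ℝ} (hx : Irrational x) : |Tmap x| < 1 := by
  have h1 := Int.ceil_lt_add_one (((-1 / x) - 1) / 2)
  have h2 := Int.le_ceil (((-1 / x) - 1) / 2)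
  have h3 : Tmap x ≠ 1 := by simpa using (irrational_Tmap hx).ne_one
  rw [abs_lt]
  refine ⟨?_, lt_of_le_of_ne ?_ h3⟩ <;> rw [Tmap] <;> linarith

theorem irrational_iterate_Tmap {x : ℝ} (hirr : Irrational x) (j : ℕ) :
    Irrational (Tmap^[j] x) := by
  induction j with
  | zero => exact hirr
  | succ j ih => rw [Function.iterate_succ_apply']; exact irrational_Tmap ih

theorem abs_iterate_Tmap_lt_one {x : ℝ} (hx : |x| < 1) (hirr : Irrational x) (j : ℕ) :
    |Tmap^[j] x| < 1 := by
  cases j with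
  | zero => exact hx
  | succ j =>
    rw [Function.iterate_succ_apply']
    exact abs_Tmap_lt_one (irrational_iterate_Tmap hirr j)

/-- The `n`-th remainder `θ_n` of the regular continued fraction expansion of `x ∈ (0,1)`. -/
noncomputable def gaussRem (x : ℝ) (n : ℕ) : ℝ := (fun t : ℝ => Int.fract t⁻¹)^[n] x

/-- The product `θ_0 ⋯ θ_{n-1}` of the first remainders. -/
noncomputable def gaussProd (x : ℝ) (n : ℕ) : ℝ := ∏ k ∈ Finset.range n, gaussRem x k

/-- The partial quotient `⌊1 / θ_n⌋`. -/
noncomputable def gaussDigit (x : ℝ) (n : ℕ) : ℕ := ⌊(gaussRem x n)⁻¹⌋₊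

theorem gaussRem_succ (x : ℝ) (n : ℕ) : gaussRem x (n + 1) = Int.fract (gaussRem x n)⁻¹ :=
  Function.iterate_succ_apply' _ _ _

theorem gaussProd_succ (x : ℝ) (n : ℕ) : gaussProd x (n + 1) = gaussProd x n * gaussRem x n :=
  Finset.prod_range_succ _ _

section ContinuedFraction

variable {x : ℝ}

theorem irrational_gaussRem (hirr : Irrational x) (n : ℕ) : Irrational (gaussRem x n) := by
  induction n with
  | zero => exact hirr
  | succ n ih =>
    rw [gaussRem_succ, Int.fract]
    exact (irrational_inv_iff.2 ih).sub_intCast _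

theorem gaussRem_mem_Ioo (hx : x ∈ Set.Ioo (0 : ℝ) 1) (hirr : Irrational x) (n : ℕ) :
    gaussRem x n ∈ Set.Ioo (0 : ℝ) 1 := by
  cases n with
  | zero => exact hx
  | succ n =>
    have h0 := (irrational_gaussRem hirr (n + 1)).ne_zero
    rw [gaussRem_succ] at h0 ⊢
    exact ⟨lt_of_le_of_ne (Int.fract_nonneg _) h0.symm, Int.fract_lt_one _⟩

theorem gaussProd_pos (hx : x ∈ Set.Ioo (0 : ℝ) 1) (hirr : Irrational x) (n : ℕ) :
    0 < gaussProd x n :=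
  Finset.prod_pos fun k _ => (gaussRem_mem_Ioo hx hirr k).1

theorem one_div_gaussRem (hx : x ∈ Set.Ioo (0 : ℝ) 1) (hirr : Irrational x) (n : ℕ) :
    1 / gaussRem x n = gaussDigit x n + gaussRem x (n + 1) := by
  have h := (gaussRem_mem_Ioo hx hirr n).1
  rw [gaussRem_succ, gaussDigit, natCast_floor_eq_intCast_floor (by positivity), one_div,
    Int.floor_add_fract]

theorem gaussDigit_pos (hx : x ∈ Set.Ioo (0 : ℝ) 1) (hirr : Irrational x) (n : ℕ) :
    0 < gaussDigit x n := by
  obtain ⟨h, h'⟩ := gaussRem_mem_Ioo hx hirr n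
  exact Nat.floor_pos.2 ((one_lt_inv₀ h).2 h').le

theorem exists_stream_eq (hx : x ∈ Set.Ioo (0 : ℝ) 1) (hirr : Irrational x) (n : ℕ) :
    ∃ b : ℤ, GenContFract.IntFractPair.stream x n = some ⟨b, gaussRem x n⟩ := by
  induction n with
  | zero =>
    refine ⟨⌊x⌋, ?_⟩
    rw [GenContFract.IntFractPair.stream_zero, GenContFract.IntFractPair.of,
      Int.fract_eq_self.2 ⟨hx.1.le, hx.2⟩]
    rfl
  | succ n ih =>
    obtain ⟨b, hb⟩ := ih
    refine ⟨⌊(gaussRem x n)⁻¹⌋, ?_⟩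
    rw [GenContFract.IntFractPair.stream_succ_of_some hb (irrational_gaussRem hirr n).ne_zero,
      gaussRem_succ]
    rfl

theorem of_s_get?_eq (hx : x ∈ Set.Ioo (0 : ℝ) 1) (hirr : Irrational x) (n : ℕ) :
    (GenContFract.of x).s.get? n = some ⟨1, (gaussDigit x n : ℝ)⟩ := by
  obtain ⟨b, hb⟩ := exists_stream_eq hx hirr n
  have h := (gaussRem_mem_Ioo hx hirr n).1
  rw [GenContFract.get?_of_eq_some_of_succ_get?_intFractPair_stream
    (GenContFract.IntFractPair.stream_succ_of_some hb (irrational_gaussRem hirr n).ne_zero),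
    gaussDigit, natCast_floor_eq_intCast_floor (by positivity)]
  rfl

theorem one_div_gaussProd_succ (hx : x ∈ Set.Ioo (0 : ℝ) 1) (hirr : Irrational x) (n : ℕ) :
    1 / gaussProd x (n + 1) = Qden x (n + 1) + gaussRem x (n + 1) * Qden x n := by
  have hn := one_div_gaussRem hx hirr n
  have h0 := (gaussRem_mem_Ioo hx hirr n).1.ne'
  induction n with
  | zero =>
    have h1 : Qden x 1 = gaussDigit x 0 := GenContFract.first_den_eq (of_s_get?_eq hx hirr 0)
    have h2 : Qden x 0 = 1 := GenContFract.zeroth_den_eq_one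
    rw [gaussProd_succ, h1, h2, gaussProd, Finset.prod_range_zero, one_mul, hn, mul_one]
  | succ n ih =>
    have h1 : Qden x (n + 2) = gaussDigit x (n + 1) * Qden x (n + 1) + 1 * Qden x n :=
      GenContFract.dens_recurrence (of_s_get?_eq hx hirr (n + 1)) rfl rfl
    have ih := ih (one_div_gaussRem hx hirr n) (gaussRem_mem_Ioo hx hirr n).1.ne'
    rw [gaussProd_succ, ← one_div_mul_one_div, ih, h1, add_mul, mul_right_comm,
      mul_one_div_cancel h0, hn]
    ring

theorem one_le_Qden (n : ℕ) : 1 ≤ Qden x n := by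
  induction n with
  | zero => exact (GenContFract.zeroth_den_eq_one (g := GenContFract.of x)).ge
  | succ n ih => exact ih.trans GenContFract.of_den_mono

theorem Qden_le_one_div_gaussProd (hx : x ∈ Set.Ioo (0 : ℝ) 1) (hirr : Irrational x) (n : ℕ) :
    Qden x n ≤ 1 / gaussProd x n ∧ 1 / gaussProd x n ≤ 2 * Qden x n := by
  cases n with
  | zero =>
    have h : Qden x 0 = 1 := GenContFract.zeroth_den_eq_one
    rw [h, gaussProd, Finset.prod_range_zero]
    norm_num
  | succ n =>
    obtain ⟨h, h'⟩ := gaussRem_mem_Ioo hx hirr (n + 1)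
    have h1 : Qden x n ≤ Qden x (n + 1) := GenContFract.of_den_mono
    have h2 := one_le_Qden (x := x) n
    rw [one_div_gaussProd_succ hx hirr]
    constructor <;> nlinarith

theorem iterate_Tmap_enter (hx : x ∈ Set.Ioo (0 : ℝ) 1) (hirr : Irrational x) {j n c : ℕ}
    (h : 1 / |Tmap^[j] x| = c + gaussRem x n)
    (hp : (∏ ℓ ∈ Finset.range j, |Tmap^[ℓ] x|) * |Tmap^[j] x| = gaussProd x n) :
    (|Tmap^[j + 1] x| = gaussRem x n ∨
      |Tmap^[j + 1] x| = 1 - 1 / (1 / gaussRem x n - (0 : ℕ))) ∧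
    ∏ ℓ ∈ Finset.range (j + 1), |Tmap^[ℓ] x| = gaussProd x n * (1 - (0 : ℕ) * gaussRem x n) := by
  obtain ⟨h1, h2⟩ := gaussRem_mem_Ioo hx hirr n
  rw [Finset.prod_range_succ, hp, Function.iterate_succ_apply', Nat.cast_zero, sub_zero,
    one_div_one_div, zero_mul, sub_zero, mul_one]
  exact ⟨abs_Tmap_eq_or (irrational_iterate_Tmap hirr j).ne_zero c h h1 h2, rfl⟩

/-- Every iterate of `T` is matched with a position in the regular continued fraction expansion;
the positions matched with iterates of modulus `< 1 / 2` are strictly increasing. -/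
theorem exists_sum_le_sum_gauss (hx : x ∈ Set.Ioo (0 : ℝ) 1) (hirr : Irrational x)
    {F G : ℕ → ℝ} (hF : ∀ n, 0 ≤ F n) (hG : ∀ j, 1 / 2 ≤ |Tmap^[j] x| → G j ≤ 0)
    (hFG : ∀ j n, ∏ ℓ ∈ Finset.range j, |Tmap^[ℓ] x| ≤ 2 * gaussProd x n →
      gaussRem x n / 2 ≤ |Tmap^[j] x| → G j ≤ F n) (N : ℕ) :
    ∃ n, (∑ j ∈ Finset.range N, G j ≤ ∑ i ∈ Finset.range n, F i ∧
        |Tmap^[N] x| = gaussRem x n ∧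
        ∏ ℓ ∈ Finset.range N, |Tmap^[ℓ] x| = gaussProd x n) ∨
      (∑ j ∈ Finset.range N, G j ≤ ∑ i ∈ Finset.range (n + 1), F i ∧
        ∃ k < gaussDigit x n, |Tmap^[N] x| = 1 - 1 / (1 / gaussRem x n - k) ∧
          ∏ ℓ ∈ Finset.range N, |Tmap^[ℓ] x| = gaussProd x n * (1 - k * gaussRem x n)) := by
  induction N with
  | zero =>
    refine ⟨0, Or.inl ⟨by simp, ?_, by simp [gaussProd]⟩⟩
    exact abs_of_pos hx.1
  | succ N ih =>
    obtain ⟨n, ⟨hs, hX, hp⟩ | ⟨hs, k, hk, hX, hp⟩⟩ := ih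
    · obtain ⟨h1, h2⟩ := gaussRem_mem_Ioo hx hirr n
      have hg : G N ≤ F n := hFG N n (by linarith [gaussProd_pos hx hirr n]) (by linarith)
      have hs' : ∑ j ∈ Finset.range (N + 1), G j ≤ ∑ i ∈ Finset.range (n + 1), F i := by
        rw [Finset.sum_range_succ, Finset.sum_range_succ]
        linarith
      obtain ⟨h | h, h'⟩ := iterate_Tmap_enter hx hirr (j := N) (n := n + 1)
        (by rw [hX]; exact one_div_gaussRem hx hirr n) (by rw [hX, hp, gaussProd_succ])
      · exact ⟨n + 1, Or.inl ⟨hs', h, by simpa using h'⟩⟩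
      · refine ⟨n + 1, Or.inr ⟨?_, 0, gaussDigit_pos hx hirr _, h, h'⟩⟩
        rw [Finset.sum_range_succ F]
        linarith [hF (n + 1)]
    · obtain ⟨h1, h2⟩ := gaussRem_mem_Ioo hx hirr n
      obtain ⟨h1', h2'⟩ := gaussRem_mem_Ioo hx hirr (n + 1)
      have hP := gaussProd_pos hx hirr n
      have hW := one_div_gaussRem hx hirr n
      have hmul : gaussRem x n * (1 / gaussRem x n) = 1 := by field_simp
      set θ := gaussRem x n
      set W := 1 / θ
      rcases Nat.lt_or_ge (k + 1) (gaussDigit x n) with hlt | hge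
      · have hc : (k : ℝ) + 2 ≤ gaussDigit x n := by exact_mod_cast hlt
        have hm : 2 < W - k := by linarith
        have hmm : (W - k) * (1 / (W - k)) = 1 := by
          have : W - k ≠ 0 := by linarith
          field_simp
        have hhalf : 1 / 2 < |Tmap^[N] x| := by rw [hX]; nlinarith
        have hN := Tmap_of_half_lt hhalf (by rw [hX]; nlinarith)
        refine ⟨n, Or.inr ⟨?_, k + 1, hlt, ?_, ?_⟩⟩
        · rw [Finset.sum_range_succ]
          linarith [hG N hhalf.le]
        · rw [Function.iterate_succ_apply', hN.1, hX]
          have ha : W - k ≠ 0 := by linarith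
          have hb : W - k - 1 ≠ 0 := by linarith
          have e : W - (k + 1 : ℕ) = W - k - 1 := by push_cast; ring
          change 2 - 1 / (1 - 1 / (W - k)) = 1 - 1 / (W - (k + 1 : ℕ))
          rw [e, one_sub_div ha, one_div_div]
          generalize W - k = V at ha hb
          field_simp
          ring
        · rw [Finset.prod_range_succ, hp, hX]
          push_cast
          have e1 : 1 - k * θ = θ * (W - k) := by linear_combination -hmul
          have e2 : 1 - (k + 1) * θ = θ * (W - k - 1) := by linear_combination -hmul
          rw [e1, e2]
          linear_combination (-gaussProd x n * θ) * hmm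
      · have hk' : gaussDigit x n = k + 1 := by omega
        have hWk : W - k = 1 + gaussRem x (n + 1) := by
          rw [hW, hk']
          push_cast
          ring
        have hnext := one_div_gaussRem hx hirr (n + 1)
        rw [hWk] at hX
        have e1 : 1 - k * θ = θ * (1 + gaussRem x (n + 1)) := by
          rw [← hWk]
          linear_combination -hmul
        rw [e1, ← mul_assoc, ← gaussProd_succ] at hp
        have hP' := gaussProd_pos hx hirr (n + 1)
        have hX' : |Tmap^[N] x| = gaussRem x (n + 1) / (1 + gaussRem x (n + 1)) := by
          rw [hX]
          field_simp
          ring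
        have hg : G N ≤ F (n + 1) := by
          refine hFG N (n + 1) (by nlinarith) ?_
          rw [hX']
          gcongr
          linarith
        have hs' : ∑ j ∈ Finset.range (N + 1), G j ≤ ∑ i ∈ Finset.range (n + 2), F i := by
          rw [Finset.sum_range_succ, Finset.sum_range_succ _ (n + 1)]
          linarith
        obtain ⟨h | h, h'⟩ := iterate_Tmap_enter hx hirr (j := N) (n := n + 2)
          (c := gaussDigit x (n + 1) + 1)
          (by
            rw [hX', one_div_div, add_div, div_self h1'.ne', hnext]
            push_cast
            ring)
          (by
            rw [hX', hp, gaussProd_succ x (n + 1)]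
            field_simp)
        · exact ⟨n + 2, Or.inl ⟨hs', h, by simpa using h'⟩⟩
        · refine ⟨n + 2, Or.inr ⟨?_, 0, gaussDigit_pos hx hirr _, h, h'⟩⟩
          rw [Finset.sum_range_succ F]
          linarith [hF (n + 2)]

end ContinuedFraction

/-- Away from a summable contribution of the iterates of modulus `< 1 / 2`, the terms of the
series are bounded by a multiple of `(∏ |T^ℓ x|) ^ α`. -/
theorem exists_summable_term_le {x : ℝ} (hx : x ∈ Set.Ioo (0 : ℝ) 1) (hirr : Irrational x)
    {α β : ℝ} (hα : 0 < α)
    (hsum : Summable (fun n : ℕ => Qden x (n + 2) ^ β / Qden x (n + 1) ^ (α + β))) :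
    ∃ (G : ℕ → ℝ) (C : ℝ), Summable G ∧ (∀ j, 0 ≤ G j) ∧ 0 ≤ C ∧ ∀ j,
      (∏ ℓ ∈ Finset.range j, |Tmap^[ℓ] x|) ^ α / |Tmap^[j] x| ^ β ≤
        G j + C * (∏ ℓ ∈ Finset.range j, |Tmap^[ℓ] x|) ^ α := by
  have hy0 : ∀ j, 0 < |Tmap^[j] x| := fun j => abs_pos.2 (irrational_iterate_Tmap hirr j).ne_zero
  have hy1 : ∀ j, |Tmap^[j] x| < 1 :=
    abs_iterate_Tmap_lt_one (by rw [abs_of_pos hx.1]; exact hx.2) hirr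
  have hp0 : ∀ j, 0 < ∏ ℓ ∈ Finset.range j, |Tmap^[ℓ] x| :=
    fun j => Finset.prod_pos fun k _ => hy0 k
  rcases le_or_gt β 0 with hβ | hβ
  · refine ⟨fun _ => 0, 1, summable_zero, fun _ => le_rfl, zero_le_one, fun j => ?_⟩
    rw [zero_add, one_mul]
    exact div_le_self (Real.rpow_nonneg (hp0 j).le _)
      (Real.one_le_rpow_of_pos_of_le_one_of_nonpos (hy0 j) (hy1 j).le hβ)
  set F : ℕ → ℝ := fun n => 2 ^ α * 4 ^ β * (Qden x (n + 1) ^ β / Qden x n ^ (α + β))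
  have hQ : ∀ n, 0 < Qden x n := fun n => one_pos.trans_le (one_le_Qden n)
  have hF0 : ∀ n, 0 ≤ F n := fun n => by
    have := hQ n
    have := hQ (n + 1)
    positivity
  have hF : Summable F := by
    refine Summable.mul_left _ ?_
    exact (summable_nat_add_iff
      (f := fun n => Qden x (n + 1) ^ β / Qden x n ^ (α + β)) 1).1 hsum
  set G : ℕ → ℝ := fun j => if |Tmap^[j] x| < 1 / 2 then
    (∏ ℓ ∈ Finset.range j, |Tmap^[ℓ] x|) ^ α / |Tmap^[j] x| ^ β else 0 with hGdef
  have hf0 : ∀ j, 0 ≤ (∏ ℓ ∈ Finset.range j, |Tmap^[ℓ] x|) ^ α / |Tmap^[j] x| ^ β := fun j =>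
    div_nonneg (Real.rpow_nonneg (hp0 j).le _) (Real.rpow_nonneg (hy0 j).le _)
  have hG0 : ∀ j, 0 ≤ G j := fun j => by
    simp only [hGdef]
    split_ifs
    exacts [hf0 j, le_rfl]
  refine ⟨G, 2 ^ |-β|, ?_, hG0, by positivity, fun j => ?_⟩
  · have hGF : ∀ j n, ∏ ℓ ∈ Finset.range j, |Tmap^[ℓ] x| ≤ 2 * gaussProd x n →
        gaussRem x n / 2 ≤ |Tmap^[j] x| → G j ≤ F n := by
      intro j n hp hy
      have hθ := (gaussRem_mem_Ioo hx hirr n).1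
      have hP := gaussProd_pos hx hirr n
      have hP' := gaussProd_pos hx hirr (n + 1)
      have hQn := hQ n
      have hQn' := hQ (n + 1)
      have h1 := (Qden_le_one_div_gaussProd hx hirr n).1
      have h2 := (Qden_le_one_div_gaussProd hx hirr (n + 1)).2
      rw [le_div_iff₀ hP] at h1
      rw [div_le_iff₀ hP', gaussProd_succ] at h2
      have h3 : Qden x n / (4 * Qden x (n + 1)) ≤ |Tmap^[j] x| := by
        refine le_trans ?_ hy
        rw [div_le_iff₀ (by positivity)]
        nlinarith [mul_le_mul_of_nonneg_left h1 (mul_pos hQn' hθ).le]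
      have h4 : ∏ ℓ ∈ Finset.range j, |Tmap^[ℓ] x| ≤ 2 / Qden x n := by
        refine hp.trans ?_
        rw [le_div_iff₀ hQn]
        linarith
      have hG : G j ≤ (∏ ℓ ∈ Finset.range j, |Tmap^[ℓ] x|) ^ α / |Tmap^[j] x| ^ β := by
        simp only [hGdef]
        split_ifs
        exacts [le_rfl, hf0 j]
      calc G j ≤ (∏ ℓ ∈ Finset.range j, |Tmap^[ℓ] x|) ^ α / |Tmap^[j] x| ^ β := hG
        _ ≤ (2 / Qden x n) ^ α / (Qden x n / (4 * Qden x (n + 1))) ^ β := by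
          gcongr
        _ = F n := by
          simp only [F]
          rw [Real.div_rpow two_pos.le hQn.le, Real.div_rpow hQn.le (by positivity),
            Real.mul_rpow four_pos.le hQn'.le, Real.rpow_add hQn]
          field_simp
    refine summable_of_sum_range_le (c := ∑' n, F n) hG0 fun N => ?_
    obtain ⟨n, ⟨h, -⟩ | ⟨h, -⟩⟩ := exists_sum_le_sum_gauss hx hirr (G := G) hF0
      (fun j hj => (if_neg hj.not_gt).le) hGF N
    · exact h.trans (hF.sum_le_tsum _ fun i _ => hF0 i)
    · exact h.trans (hF.sum_le_tsum _ fun i _ => hF0 i)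
  · by_cases hj : |Tmap^[j] x| < 1 / 2
    · simp only [hGdef, if_pos hj]
      exact le_add_of_nonneg_right (mul_nonneg (by positivity) (Real.rpow_nonneg (hp0 j).le _))
    · simp only [hGdef, if_neg hj, zero_add]
      rw [div_eq_mul_inv, ← Real.rpow_neg (hy0 j).le, mul_comm]
      exact mul_le_mul_of_nonneg_right (rpow_le_two_rpow_abs (not_lt.1 hj) (hy1 j).le _)
        (Real.rpow_nonneg (hp0 j).le _)

theorem tendsto_prod_abs_iterate_Tmap {x : ℝ} (hx : x ∈ Set.Ioo (0 : ℝ) 1)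
    (hirr : Irrational x) :
    Tendsto (fun j => ∏ ℓ ∈ Finset.range j, |Tmap^[ℓ] x|) atTop (𝓝 0) := by
  have hy0 : ∀ j, 0 < |Tmap^[j] x| := fun j => abs_pos.2 (irrational_iterate_Tmap hirr j).ne_zero
  have hy1 : ∀ j, |Tmap^[j] x| < 1 :=
    abs_iterate_Tmap_lt_one (by rw [abs_of_pos hx.1]; exact hx.2) hirr
  set p : ℕ → ℝ := fun j => ∏ ℓ ∈ Finset.range j, |Tmap^[ℓ] x|
  have hp0 : ∀ j, 0 < p j := fun j => Finset.prod_pos fun k _ => hy0 k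
  have hps : ∀ j, p (j + 1) = p j * |Tmap^[j] x| := fun j => Finset.prod_range_succ _ _
  have hanti : Antitone p := antitone_nat_of_succ_le fun j => by
    rw [hps]
    exact mul_le_of_le_one_right (hp0 j).le (hy1 j).le
  have hlim := tendsto_atTop_ciInf hanti ⟨0, by rintro _ ⟨j, rfl⟩; exact (hp0 j).le⟩
  set l := ⨅ j, p j
  rcases eq_or_ne l 0 with h | h
  · rwa [h] at hlim
  exfalso
  have hy : Tendsto (fun j => |Tmap^[j] x|) atTop (𝓝 1) := by
    have := ((tendsto_add_atTop_iff_nat 1).2 hlim).div hlim h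
    rw [div_self h] at this
    refine this.congr fun j => ?_
    rw [Pi.div_apply, hps, mul_div_cancel_left₀ _ (hp0 j).ne']
  obtain ⟨J, hJ⟩ := eventually_atTop.1 (hy.eventually (lt_mem_nhds (show (1 / 2 : ℝ) < 1 by norm_num)))
  have hdec : ∀ j ≥ J, |Tmap^[j] x| ≤ |Tmap^[J] x| := by
    intro j hj
    induction j, hj using Nat.le_induction with
    | base => rfl
    | succ j hj ih =>
      refine le_trans ?_ ih
      rw [Function.iterate_succ_apply', (Tmap_of_half_lt (hJ j hj) (hy1 j)).1]
      have h1 : |Tmap^[j] x| * (1 / |Tmap^[j] x|) = 1 := mul_one_div_cancel (hy0 j).ne'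
      nlinarith [hy0 j, hy1 j, sq_nonneg (|Tmap^[j] x| - 1), one_div_pos.2 (hy0 j)]
  exact absurd (le_of_tendsto hy (eventually_atTop.2 ⟨J, hdec⟩)) (hy1 J).not_ge

theorem exp_pi_mul_I_div_four_mul_ne_one {s : ℝ} (hs : s = 1 ∨ s = -1) :
    Complex.exp (Real.pi * Complex.I / 4 * s) ≠ 1 := by
  intro h
  have h4 : Complex.exp (Real.pi * Complex.I / 4 * s) ^ 4 = -1 := by
    rw [← Complex.exp_nat_mul]
    rcases hs with rfl | rfl
    · rw [← Complex.exp_pi_mul_I]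
      congr 1
      push_cast
      ring
    · rw [show ((4 : ℕ) * (Real.pi * Complex.I / 4 * (-1 : ℝ)) : ℂ) = -(Real.pi * Complex.I) by
        push_cast
        ring, Complex.exp_neg, Complex.exp_pi_mul_I]
      norm_num
  rw [h] at h4
  norm_num at h4

/-- convergence of the twisted series with `1/|T^j x|^β` under
`Σ Q_{n+1}^β / Q_n^{α+β} < ∞`. -/
theorem stmt18 (α : ℝ) (hα : 0 < α) (β : ℝ)
    (x : ℝ) (hx : x ∈ Set.Ioo (0 : ℝ) 1) (hirr : Irrational x)
    (hsum : Summable (fun n : ℕ => Qden x (n + 2) ^ β / Qden x (n + 1) ^ (α + β))) :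
    ∃ L : ℂ, Tendsto (fun N : ℕ => ∑ j ∈ Finset.range N,
      Complex.exp (Real.pi * Complex.I / 4
          * ((∑ ℓ ∈ Finset.range j, Real.sign (Tmap^[ℓ] x) : ℝ) : ℂ))
        * (((∏ ℓ ∈ Finset.range j, |Tmap^[ℓ] x|) ^ α / |Tmap^[j] x| ^ β : ℝ) : ℂ))
      atTop (𝓝 L) := by
  have hy0 : ∀ j, 0 < |Tmap^[j] x| := fun j => abs_pos.2 (irrational_iterate_Tmap hirr j).ne_zero
  have hy1 : ∀ j, |Tmap^[j] x| < 1 :=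
    abs_iterate_Tmap_lt_one (by rw [abs_of_pos hx.1]; exact hx.2) hirr
  have hsign : ∀ j, Real.sign (Tmap^[j] x) = 1 ∨ Real.sign (Tmap^[j] x) = -1 := fun j => by
    rcases (irrational_iterate_Tmap hirr j).ne_zero.lt_or_gt with h | h
    exacts [Or.inr (Real.sign_of_neg h), Or.inl (Real.sign_of_pos h)]
  obtain ⟨G, C, hGs, hG0, hC, hfG⟩ := exists_summable_term_le hx hirr hα hsum
  obtain ⟨B, hB, hnear⟩ := exists_abs_rpow_mul_sub_le hα β
  have hp0 : ∀ j, 0 < ∏ ℓ ∈ Finset.range j, |Tmap^[ℓ] x| :=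
    fun j => Finset.prod_pos fun k _ => hy0 k
  set u : ℕ → ℝ := fun j => (∏ ℓ ∈ Finset.range j, |Tmap^[ℓ] x|) ^ α with hu
  set f : ℕ → ℝ := fun j => (∏ ℓ ∈ Finset.range j, |Tmap^[ℓ] x|) ^ α / |Tmap^[j] x| ^ β with hf
  have hu0 : ∀ j, 0 < u j := fun j => Real.rpow_pos_of_pos (hp0 j) _
  have hus : ∀ j, u (j + 1) = u j * |Tmap^[j] x| ^ α := fun j => by
    simp only [hu]
    rw [Finset.prod_range_succ, Real.mul_rpow (hp0 j).le (hy0 j).le]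
  have hyα : ∀ j, |Tmap^[j] x| ^ α ≤ 1 := fun j => Real.rpow_le_one (hy0 j).le (hy1 j).le hα.le
  have hf0 : ∀ j, 0 ≤ f j := fun j => div_nonneg (hu0 j).le (Real.rpow_nonneg (hy0 j).le _)
  have hulim : Tendsto u atTop (𝓝 0) := by
    have := (tendsto_prod_abs_iterate_Tmap hx hirr).rpow_const (p := α) (Or.inr hα.le)
    rwa [Real.zero_rpow hα.ne'] at this
  have hflim : Tendsto f atTop (𝓝 0) := by
    refine squeeze_zero hf0 hfG ?_
    simpa using hGs.tendsto_atTop_zero.add (hulim.const_mul C)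
  have hdu0 : ∀ j, 0 ≤ u j - u (j + 1) := fun j => by
    rw [hus]
    nlinarith [hu0 j, hyα j]
  have hdu : Summable fun j => u j - u (j + 1) := by
    refine summable_of_sum_range_le (c := u 0) hdu0 fun N => ?_
    rw [Finset.sum_range_sub']
    linarith [hu0 N]
  set κ : ℝ → ℂ := fun s => 1 / (Complex.exp (Real.pi * Complex.I / 4 * s) - 1) with hκ
  set K : ℝ := ‖κ 1‖ + ‖κ (-1)‖ with hKdef
  have hK : ∀ j, ‖κ (Real.sign (Tmap^[j] x))‖ ≤ K := fun j => by
    rcases hsign j with h | h <;> rw [h]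
    exacts [le_add_of_nonneg_right (norm_nonneg _), le_add_of_nonneg_left (norm_nonneg _)]
  have hK0 : 0 ≤ K := (norm_nonneg _).trans (hK 0)
  set δ : ℝ := 1 - (2 / 3 : ℝ) ^ α with hδ
  have hδ0 : 0 < δ := sub_pos.2 (Real.rpow_lt_one (by norm_num) (by norm_num) hα)
  refine exists_tendsto_sum_of_summation_by_parts (K := K)
    (κ := fun j => κ (Real.sign (Tmap^[j] x))) (f := f) (fun j => ?_) (fun j => ?_) hK hflim ?_
  · rw [show (Real.pi * Complex.I / 4 *
        ((∑ ℓ ∈ Finset.range j, Real.sign (Tmap^[ℓ] x) : ℝ) : ℂ) : ℂ) =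
        ((Real.pi / 4 * ∑ ℓ ∈ Finset.range j, Real.sign (Tmap^[ℓ] x) : ℝ) : ℂ) * Complex.I by
      push_cast
      ring]
    exact Complex.norm_exp_ofReal_mul_I _
  · have hne := sub_ne_zero.2 (exp_pi_mul_I_div_four_mul_ne_one (hsign j))
    rw [Finset.sum_range_succ, Complex.ofReal_add, mul_add, Complex.exp_add]
    simp only [hκ]
    rw [← mul_sub_one, mul_assoc, mul_one_div_cancel hne, mul_one]
  · refine Summable.of_nonneg_of_le (fun _ => norm_nonneg _) (fun j => ?_)
      ((((hGs.add ((summable_nat_add_iff 1).2 hGs)).add (hdu.mul_left (B + 2 * C / δ))).mul_left K))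
    have hd1 := hdu0 j
    have hg1 := hG0 j
    have hg2 := hG0 (j + 1)
    by_cases hy : 2 / 3 ≤ |Tmap^[j] x|
    · obtain ⟨h1, h2⟩ := Tmap_of_half_lt (by linarith) (hy1 j)
      rw [Function.iterate_succ_apply', h2, ← mul_sub, norm_mul, ← Complex.ofReal_sub,
        Complex.norm_real, Real.norm_eq_abs]
      have hdf : |f (j + 1) - f j| ≤ B * (u j - u (j + 1)) := by
        have e : f (j + 1) - f j = u j * (|Tmap^[j] x| ^ α / (2 - 1 / |Tmap^[j] x|) ^ β -
            1 / |Tmap^[j] x| ^ β) := by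
          change u (j + 1) / |Tmap^[j + 1] x| ^ β - u j / |Tmap^[j] x| ^ β = _
          rw [hus, Function.iterate_succ_apply', h1]
          ring
        rw [e, abs_mul, abs_of_pos (hu0 j), hus]
        calc _ ≤ u j * (B * (1 - |Tmap^[j] x| ^ α)) :=
              mul_le_mul_of_nonneg_left (hnear _ hy (hy1 j)) (hu0 j).le
          _ = _ := by ring
      refine mul_le_mul (hK j) (hdf.trans ?_) (abs_nonneg _) hK0
      have : 0 ≤ 2 * C / δ * (u j - u (j + 1)) := by positivity
      linarith
    · have hdu' : u j * δ ≤ u j - u (j + 1) := by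
        have := Real.rpow_le_rpow (hy0 j).le (not_le.1 hy).le hα.le
        rw [hus]
        nlinarith [hu0 j]
      have huj : C * u j ≤ C / δ * (u j - u (j + 1)) := by
        calc C * u j = C / δ * (u j * δ) := by field_simp
          _ ≤ _ := by gcongr
      have hcu : C * u (j + 1) ≤ C * u j := mul_le_mul_of_nonneg_left (by linarith) hC
      have hff : f (j + 1) + f j ≤ G j + G (j + 1) + (B + 2 * C / δ) * (u j - u (j + 1)) := by
        have hb : 0 ≤ B * (u j - u (j + 1)) := mul_nonneg hB hd1
        have e : (B + 2 * C / δ) * (u j - u (j + 1)) =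
          B * (u j - u (j + 1)) + 2 * (C / δ * (u j - u (j + 1))) := by ring
        have := hfG j
        have := hfG (j + 1)
        rw [e]
        linarith
      refine (norm_sub_le _ _).trans ?_
      rw [norm_mul, norm_mul, Complex.norm_real, Complex.norm_real, Real.norm_eq_abs,
        Real.norm_eq_abs, abs_of_nonneg (hf0 _), abs_of_nonneg (hf0 _)]
      calc _ ≤ K * f (j + 1) + K * f j :=
            add_le_add (mul_le_mul_of_nonneg_right (hK _) (hf0 _))
              (mul_le_mul_of_nonneg_right (hK _) (hf0 _))
        _ = K * (f (j + 1) + f j) := by ring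
        _ ≤ _ := mul_le_mul_of_nonneg_left hff hK0
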